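/- Assume the sufficient condition √t·(‖a‖²_{H¹} − a₀²)^{1/2} < √((a₀ + ρ/(4π²))² + a₀²) − (a₀ + ρ/(4π²)). Let Λ = Λ^{HC}_{d,n} = {ν ∈ ℤ^d : Π_{k=1}^d (|ν_k|+1) ≤ n} be the hyperbolic cross of order n. Then the family {L[Ψ_ν]}_{ν∈Λ} is a bounded Riesz system: for every complex vector z = (z_ν)_{ν∈Λ}, b_Φ · Σ_{ν∈Λ}|z_ν|² ≤ ∫_{[0,1]^d} | Σ_{ν∈Λ} z_ν L[Ψ_ν](x) |² dx ≤ B_Φ · Σ_{ν∈Λ}|z_ν|², where b_Φ = a₀² − (2a₀ + ρ/(2π²))β − β² > 0 and B_Φ = ‖a‖²_{H¹} + ρ²/(16π⁴) + a₀ρ/(2π²) + (2a₀ + ρ/(2π²))β + β². -/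

import Mathlib

open Finset MeasureTheory

noncomputable def fourF (d : ℕ) (ν : Fin d → ℤ) (x : Fin d → ℝ) : ℂ :=
  Complex.exp (2 * (Real.pi : ℂ) * Complex.I * ∑ j, (ν j : ℂ) * (x j : ℂ))

noncomputable def pdv (d : ℕ) (k : Fin d) (f : (Fin d → ℝ) → ℂ) : (Fin d → ℝ) → ℂ :=
  fun x => fderiv ℝ f x (Pi.single k 1)

noncomputable def lapl (d : ℕ) (f : (Fin d → ℝ) → ℂ) : (Fin d → ℝ) → ℂ :=
  fun x => ∑ k, pdv d k (pdv d k f) x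

noncomputable def sqL2 (d : ℕ) (f : (Fin d → ℝ) → ℂ) : ℝ :=
  ∫ x in Set.Icc (0 : Fin d → ℝ) 1, ‖f x‖ ^ 2

noncomputable def sqH2 (d : ℕ) (f : (Fin d → ℝ) → ℂ) : ℝ :=
  sqL2 d f + (∑ k : Fin d, sqL2 d (pdv d k f)) +
    ∑ k : Fin d, ∑ l : Fin d, sqL2 d (pdv d k (pdv d l f))

noncomputable def enorm2Z (d : ℕ) (ν : Fin d → ℤ) : ℝ := ∑ j, ((ν j : ℝ)) ^ 2

noncomputable def dotZR (d : ℕ) (τ ν : Fin d → ℤ) : ℝ := ∑ j, (τ j : ℝ) * (ν j : ℝ)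

noncomputable def Lop (d : ℕ) (a : (Fin d → ℝ) → ℂ) (ρ : ℝ) (u : (Fin d → ℝ) → ℂ) :
    (Fin d → ℝ) → ℂ :=
  fun x => -(∑ k, pdv d k (fun y => a y * pdv d k u y) x) + (ρ : ℂ) * u x

noncomputable def GramM (d : ℕ) (a : (Fin d → ℝ) → ℂ) (ρ : ℝ)
    (Ψ : (Fin d → ℤ) → (Fin d → ℝ) → ℂ) (ν μ : Fin d → ℤ) : ℂ :=
  ∫ x in Set.Icc (0 : Fin d → ℝ) 1,
    Lop d a ρ (Ψ ν) x * (starRingEnd ℂ) (Lop d a ρ (Ψ μ) x)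

theorem fourF_add (d : ℕ) (ν μ : Fin d → ℤ) (x : Fin d → ℝ) :
    fourF d (ν + μ) x = fourF d ν x * fourF d μ x := by
  simp only [fourF, ← Complex.exp_add, Pi.add_apply, ← mul_add, ← Finset.sum_add_distrib]
  congr 2
  refine Finset.sum_congr rfl fun j _ => ?_
  push_cast
  ring

theorem conj_fourF (d : ℕ) (ν : Fin d → ℤ) (x : Fin d → ℝ) :
    (starRingEnd ℂ) (fourF d ν x) = fourF d (-ν) x := by
  simp [fourF, ← Complex.exp_conj, Finset.sum_neg_distrib, Complex.conj_ofNat]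

theorem norm_fourF (d : ℕ) (ν : Fin d → ℤ) (x : Fin d → ℝ) : ‖fourF d ν x‖ = 1 := by
  have : (2 * (Real.pi : ℂ) * Complex.I * ∑ j, (ν j : ℂ) * (x j : ℂ)) =
      ((2 * Real.pi * ∑ j, (ν j : ℝ) * x j : ℝ) : ℂ) * Complex.I := by
    push_cast
    ring
  rw [fourF, this, Complex.norm_exp_ofReal_mul_I]

theorem differentiable_fourF (d : ℕ) (ν : Fin d → ℤ) : Differentiable ℝ (fourF d ν) := by
  unfold fourF
  have h : ∀ j, Differentiable ℝ (fun x : Fin d → ℝ => (x j : ℂ)) := fun j =>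
    Complex.ofRealCLM.differentiable.comp (differentiable_apply j)
  fun_prop

theorem pdv_fourF (d : ℕ) (k : Fin d) (ν : Fin d → ℤ) (x : Fin d → ℝ) :
    pdv d k (fourF d ν) x = 2 * (Real.pi : ℂ) * Complex.I * (ν k : ℂ) * fourF d ν x := by
  have h : ∀ j, HasFDerivAt (fun x : Fin d → ℝ => (x j : ℂ))
      (Complex.ofRealCLM.comp (ContinuousLinearMap.proj (R := ℝ) (φ := fun _ : Fin d => ℝ) j)) x :=
    fun j => (Complex.ofRealCLM.comp
      (ContinuousLinearMap.proj (R := ℝ) (φ := fun _ : Fin d => ℝ) j)).hasFDerivAt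
  have h2 := ((HasFDerivAt.fun_sum (u := Finset.univ)
    (fun j _ => (h j).const_mul (ν j : ℂ))).const_mul (2 * (Real.pi : ℂ) * Complex.I)).cexp
  unfold pdv fourF
  rw [h2.fderiv]
  simp [Pi.single_apply, apply_ite ((↑) : ℝ → ℂ)]
  ring

theorem integral_fourF (d : ℕ) (ν : Fin d → ℤ) :
    ∫ x in Set.Icc (0 : Fin d → ℝ) 1, fourF d ν x = if ν = 0 then 1 else 0 := by
  have h1 : ∀ m : ℤ, ∫ t in Set.Icc (0 : ℝ) 1,
      Complex.exp (2 * (Real.pi : ℂ) * Complex.I * (m * t)) = if m = 0 then 1 else 0 := by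
    intro m
    rw [integral_Icc_eq_integral_Ioc, ← intervalIntegral.integral_of_le zero_le_one]
    split_ifs with hm
    · simp [hm]
    · have hc : (2 * (Real.pi : ℂ) * Complex.I * m) ≠ 0 := by
        simp [hm, Real.pi_ne_zero]
      simp only [← mul_assoc]
      rw [integral_exp_mul_complex hc]
      have : (2 * (Real.pi : ℂ) * Complex.I * m) = m * (2 * Real.pi * Complex.I) := by ring
      simp [this, Complex.exp_int_mul_two_pi_mul_I]
  have h2 : ∀ x, fourF d ν x =
      ∏ j, Complex.exp (2 * (Real.pi : ℂ) * Complex.I * (ν j * x j)) := by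
    intro x
    rw [← Complex.exp_sum, fourF, Finset.mul_sum]
  simp only [h2]
  have h3 : (Set.Icc (0 : Fin d → ℝ) 1) = Set.univ.pi fun _ => Set.Icc (0 : ℝ) 1 := by
    rw [← Set.pi_univ_Icc]; rfl
  rw [h3, volume_pi, Measure.restrict_pi_pi, integral_fintype_prod_eq_prod
    (f := fun j (t : ℝ) => Complex.exp (2 * (Real.pi : ℂ) * Complex.I * (ν j * t)))]
  simp only [h1]
  rw [Finset.prod_ite_zero]
  simp [funext_iff]

theorem Lop_smul_fourF (d : ℕ) (T : Finset (Fin d → ℤ)) (a₀ ρ r : ℝ) (aC : (Fin d → ℤ) → ℂ)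
    (ν : Fin d → ℤ) (x : Fin d → ℝ) :
    Lop d (fun x => (a₀ : ℂ) + ∑ τ ∈ T, aC τ * fourF d τ x) ρ (fun x => (r : ℂ) * fourF d ν x) x =
      ((r * (4 * Real.pi ^ 2 * a₀ * enorm2Z d ν + ρ) : ℝ) : ℂ) * fourF d ν x +
      ∑ τ ∈ T, aC τ * ((r * (4 * Real.pi ^ 2 * (dotZR d τ ν + enorm2Z d ν)) : ℝ) : ℂ) *
        fourF d (τ + ν) x := by
  have hF := differentiable_fourF d
  have h1 : ∀ k, pdv d k (fun x => (r : ℂ) * fourF d ν x) =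
      fun x => (r : ℂ) * (2 * (Real.pi : ℂ) * Complex.I * (ν k : ℂ)) * fourF d ν x := by
    intro k
    funext x
    have := pdv_fourF d k ν x
    unfold pdv at this ⊢
    rw [fderiv_const_mul (hF ν x), smul_apply, this, smul_eq_mul]
    ring
  have h2 : ∀ k, pdv d k (fun y => ((a₀ : ℂ) + ∑ τ ∈ T, aC τ * fourF d τ y) *
      ((r : ℂ) * (2 * (Real.pi : ℂ) * Complex.I * (ν k : ℂ)) * fourF d ν y)) x =
      -((r * (4 * Real.pi ^ 2) * a₀ * (ν k) ^ 2 : ℂ) * fourF d ν x) -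
      ∑ τ ∈ T, aC τ * (r * (4 * Real.pi ^ 2 * (τ k * ν k + ν k ^ 2) : ℂ)) *
        fourF d (τ + ν) x := by
    intro k
    have e : (fun y => ((a₀ : ℂ) + ∑ τ ∈ T, aC τ * fourF d τ y) *
      ((r : ℂ) * (2 * (Real.pi : ℂ) * Complex.I * (ν k : ℂ)) * fourF d ν y)) =
      fun y => (r : ℂ) * (2 * (Real.pi : ℂ) * Complex.I * (ν k : ℂ)) * (a₀ * fourF d ν y +
        ∑ τ ∈ T, aC τ * fourF d (τ + ν) y) := by
      funext y
      simp only [fourF_add, ← mul_assoc, ← Finset.sum_mul]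
      ring
    rw [e]
    have hd := (((hF ν x).hasFDerivAt.const_mul (a₀ : ℂ)).fun_add (HasFDerivAt.fun_sum (u := T)
      (fun τ _ => (hF (τ + ν) x).hasFDerivAt.const_mul (aC τ)))).const_mul
        ((r : ℂ) * (2 * (Real.pi : ℂ) * Complex.I * (ν k : ℂ)))
    have hp := fun μ => pdv_fourF d k μ x
    unfold pdv at hp ⊢
    rw [HasFDerivAt.fderiv hd]
    simp only [smul_apply, add_apply, _root_.sum_apply, hp, smul_eq_mul, mul_add, Finset.mul_sum]
    rw [sub_eq_add_neg, ← Finset.sum_neg_distrib]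
    congr 1
    · linear_combination (4 * r * (Real.pi : ℂ) ^ 2 * a₀ * ν k ^ 2 * fourF d ν x) * Complex.I_sq
    · refine Finset.sum_congr rfl fun τ _ => ?_
      push_cast [Pi.add_apply]
      linear_combination (4 * r * (Real.pi : ℂ) ^ 2 * aC τ * ν k * (τ k + ν k) *
        fourF d (τ + ν) x) * Complex.I_sq
  unfold Lop
  simp only [h1, h2]
  rw [Finset.sum_sub_distrib, Finset.sum_comm]
  simp only [← Finset.sum_mul, ← Finset.mul_sum, Finset.sum_neg_distrib, enorm2Z, dotZR,
    Finset.sum_add_distrib]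
  push_cast
  ring

/-- The Fourier function as a bounded continuous function. -/
noncomputable def fourBCF (d : ℕ) (ν : Fin d → ℤ) : BoundedContinuousFunction (Fin d → ℝ) ℂ :=
  BoundedContinuousFunction.ofNormedAddCommGroup (fourF d ν) (differentiable_fourF d ν).continuous 1
    fun x => (norm_fourF d ν x).le

instance isFiniteMeasure_restrict_unitCube (d : ℕ) :
    IsFiniteMeasure (volume.restrict (Set.Icc (0 : Fin d → ℝ) 1)) :=
  ⟨by rw [Measure.restrict_apply_univ]; exact isCompact_Icc.measure_lt_top⟩

/-- The Fourier function as an element of `L²` of the unit cube. -/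
noncomputable def fourLp (d : ℕ) (ν : Fin d → ℤ) :
    Lp ℂ 2 (volume.restrict (Set.Icc (0 : Fin d → ℝ) 1)) :=
  BoundedContinuousFunction.toLp 2 (volume.restrict (Set.Icc (0 : Fin d → ℝ) 1)) ℂ (fourBCF d ν)

theorem orthonormal_fourLp (d : ℕ) : Orthonormal ℂ (fourLp d) := by
  rw [orthonormal_iff_ite]
  intro ν μ
  rw [fourLp, fourLp, BoundedContinuousFunction.inner_toLp]
  have : ∀ x, fourBCF d μ x * (starRingEnd ℂ) (fourBCF d ν x) = fourF d (μ + -ν) x := by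
    intro x
    rw [fourF_add, ← conj_fourF]
    rfl
  simp only [this, integral_fourF, ← sub_eq_add_neg, sub_eq_zero, eq_comm]

theorem sqL2_eq_norm_toLp (d : ℕ) (f : BoundedContinuousFunction (Fin d → ℝ) ℂ) :
    sqL2 d f = ‖BoundedContinuousFunction.toLp (E := ℂ) 2
      (volume.restrict (Set.Icc (0 : Fin d → ℝ) 1)) ℂ f‖ ^ 2 := by
  rw [@norm_sq_eq_re_inner ℂ, BoundedContinuousFunction.inner_toLp]
  simp only [RCLike.mul_conj]
  rw [sqL2]
  norm_cast

theorem norm_sum_smul_add {ι E : Type*} [AddGroup ι] [NormedAddCommGroup E]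
    [InnerProductSpace ℂ E] {v : ι → E} (hv : Orthonormal ℂ v) (s : Finset ι) (w : ι → ℂ) (τ : ι) :
    ‖∑ ν ∈ s, w ν • v (τ + ν)‖ ^ 2 = ∑ ν ∈ s, ‖w ν‖ ^ 2 := by
  have h := (hv.comp _ (add_right_injective τ)).inner_sum w w s
  simp only [Function.comp] at h
  rw [@norm_sq_eq_re_inner ℂ, h]
  simp [Complex.conj_mul', ← Complex.ofReal_pow]

theorem dotZR_sq_le (d : ℕ) (τ ν : Fin d → ℤ) :
    dotZR d τ ν ^ 2 ≤ enorm2Z d τ * enorm2Z d ν :=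
  Finset.sum_mul_sq_le_sq_mul_sq _ _ _

theorem enorm2Z_nonneg (d : ℕ) (ν : Fin d → ℤ) : 0 ≤ enorm2Z d ν :=
  Finset.sum_nonneg fun _ _ => sq_nonneg _

theorem one_le_enorm2Z (d : ℕ) {ν : Fin d → ℤ} (h : ν ≠ 0) : 1 ≤ enorm2Z d ν := by
  obtain ⟨k, hk⟩ := Function.ne_iff.mp h
  have h1 : (1 : ℝ) ≤ (ν k : ℝ) ^ 2 := by
    have : (1 : ℤ) ≤ ν k ^ 2 := Int.one_le_abs hk |> fun h => by nlinarith [sq_abs (ν k)]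
    exact_mod_cast this
  exact h1.trans (Finset.single_le_sum (f := fun j => (ν j : ℝ) ^ 2)
    (fun _ _ => sq_nonneg _) (Finset.mem_univ k))

theorem coeff_abs_le (d : ℕ) {τ : Fin d → ℤ} (hτ : τ ≠ 0) (ν : Fin d → ℤ) {c : ℝ} (hc : 0 < c) :
    |1 / (4 * Real.pi ^ 2 * enorm2Z d ν + c) *
      (4 * Real.pi ^ 2 * (dotZR d τ ν + enorm2Z d ν))| ≤
      Real.sqrt (1 + 4 * Real.pi ^ 2 * enorm2Z d τ) := by
  have hp : 9 < Real.pi ^ 2 := by nlinarith [Real.pi_gt_three]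
  have ht := one_le_enorm2Z d hτ
  have hdot := dotZR_sq_le d τ ν
  have hn := enorm2Z_nonneg d ν
  apply Real.abs_le_sqrt
  rcases eq_or_ne ν 0 with rfl | hν
  · simp only [dotZR, enorm2Z, Pi.zero_apply, Int.cast_zero, mul_zero, Finset.sum_const_zero] at *
    simp
    positivity
  have hN := one_le_enorm2Z d hν
  set N := enorm2Z d ν
  set t := enorm2Z d τ
  set D := dotZR d τ ν
  have hden : 0 < 4 * Real.pi ^ 2 * N + c := by positivity
  have key : (D + N) ^ 2 ≤ (1 + 4 * Real.pi ^ 2 * t) * N ^ 2 := by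
    have h1 : D ^ 2 ≤ t * N ^ 2 := by nlinarith
    have h2 : 2 * D * N ≤ D ^ 2 + N ^ 2 := by nlinarith [sq_nonneg (D - N)]
    have h3 : 0 ≤ (t - 1) * N ^ 2 := mul_nonneg (by linarith) (sq_nonneg N)
    have h4 : 0 ≤ (Real.pi ^ 2 - 9) * (t * N ^ 2) := by
      apply mul_nonneg <;> [linarith; positivity]
    have h5 : 0 ≤ t * N ^ 2 := by positivity
    nlinarith
  rw [one_div_mul_eq_div, div_pow, div_le_iff₀ (by positivity)]
  calc (4 * Real.pi ^ 2 * (D + N)) ^ 2 = (4 * Real.pi ^ 2) ^ 2 * (D + N) ^ 2 := by ring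
    _ ≤ (4 * Real.pi ^ 2) ^ 2 * ((1 + 4 * Real.pi ^ 2 * t) * N ^ 2) := by gcongr
    _ = (1 + 4 * Real.pi ^ 2 * t) * (4 * Real.pi ^ 2 * N) ^ 2 := by ring
    _ ≤ _ := by
      gcongr
      linarith

/-- A multiple of an orthonormal synthesis operator, perturbed by weighted translates of it, has
norm within the total weight of that multiple. -/
theorem abs_norm_perturbation_le {ι E : Type*} [AddGroup ι] [NormedAddCommGroup E]
    [InnerProductSpace ℂ E] {v : ι → E} (hv : Orthonormal ℂ v) (s T : Finset ι) (z : ι → ℂ)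
    {a₀ : ℝ} (ha₀ : 0 ≤ a₀) (aC : ι → ℂ) (c : ι → ι → ℝ) (C : ι → ℝ) (hC : ∀ τ ∈ T, 0 ≤ C τ)
    (hc : ∀ τ ∈ T, ∀ ν, |c τ ν| ≤ C τ) :
    |‖∑ ν ∈ s, z ν • ((a₀ : ℂ) • v ν + ∑ τ ∈ T, (aC τ * (c τ ν : ℂ)) • v (τ + ν))‖ -
      a₀ * Real.sqrt (∑ ν ∈ s, ‖z ν‖ ^ 2)| ≤
      (∑ τ ∈ T, ‖aC τ‖ * C τ) * Real.sqrt (∑ ν ∈ s, ‖z ν‖ ^ 2) := by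
  set S := Real.sqrt (∑ ν ∈ s, ‖z ν‖ ^ 2)
  have hmain : ‖(a₀ : ℂ) • ∑ ν ∈ s, z ν • v ν‖ = a₀ * S := by
    have h := norm_sum_smul_add hv s z 0
    simp only [zero_add] at h
    rw [norm_smul, ← Real.sqrt_sq (norm_nonneg (∑ ν ∈ s, z ν • v ν)), h, Complex.norm_real,
      Real.norm_of_nonneg ha₀]
  have hdec : ∑ ν ∈ s, z ν • ((a₀ : ℂ) • v ν + ∑ τ ∈ T, (aC τ * (c τ ν : ℂ)) • v (τ + ν)) -
      (a₀ : ℂ) • ∑ ν ∈ s, z ν • v ν =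
      ∑ τ ∈ T, aC τ • ∑ ν ∈ s, (c τ ν * z ν) • v (τ + ν) := by
    simp only [Finset.smul_sum, smul_add, Finset.sum_add_distrib, smul_smul]
    rw [Finset.sum_comm (s := s) (t := T)]
    simp only [mul_comm, mul_left_comm, add_sub_cancel_left]
  rw [← hmain]
  refine (abs_norm_sub_norm_le _ _).trans ?_
  rw [hdec, Finset.sum_mul]
  refine norm_sum_le_of_le _ fun τ hτ => ?_
  rw [norm_smul, mul_assoc]
  gcongr
  rw [← Real.sqrt_sq (norm_nonneg _), norm_sum_smul_add hv, ← Real.sqrt_sq (hC τ hτ),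
    ← Real.sqrt_mul (sq_nonneg _), Finset.mul_sum]
  gcongr with ν
  rw [norm_mul, mul_pow, Complex.norm_real, Real.norm_eq_abs]
  gcongr
  exact hc τ hτ ν

theorem stmt8 (d n : ℕ) (hd : 1 ≤ d) (hn : 1 ≤ n)
    (T : Finset (Fin d → ℤ)) (hT0 : (0 : Fin d → ℤ) ∉ T) (hTsym : ∀ τ ∈ T, -τ ∈ T)
    (a₀ ρ : ℝ) (ha₀ : 0 < a₀) (hρ : 0 < ρ)
    (aC : (Fin d → ℤ) → ℂ) (haSym : ∀ τ ∈ T, aC (-τ) = (starRingEnd ℂ) (aC τ))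
    (a : (Fin d → ℝ) → ℂ) (ha : a = fun x => (a₀ : ℂ) + ∑ τ ∈ T, aC τ * fourF d τ x)
    (r : (Fin d → ℤ) → ℝ)
    (hr : r = fun ν => 1 / (4 * Real.pi ^ 2 * enorm2Z d ν + ρ / a₀))
    (Ψ : (Fin d → ℤ) → (Fin d → ℝ) → ℂ)
    (hΨ : Ψ = fun ν x => (r ν : ℂ) * fourF d ν x)
    (β : ℝ)
    (hβ : β = Real.sqrt T.card *
      Real.sqrt ((a₀ ^ 2 + ∑ τ ∈ T, (1 + 4 * Real.pi ^ 2 * enorm2Z d τ) * ‖aC τ‖ ^ 2) - a₀ ^ 2))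
    (hcond : β < Real.sqrt ((a₀ + ρ / (4 * Real.pi ^ 2)) ^ 2 + a₀ ^ 2) -
      (a₀ + ρ / (4 * Real.pi ^ 2)))
    (Λ : Finset (Fin d → ℤ))
    (hΛ : ∀ ν : Fin d → ℤ, ν ∈ Λ ↔ (∏ k, (|ν k| + 1)) ≤ (n : ℤ))
    (bΦ BΦ : ℝ)
    (hb : bΦ = a₀ ^ 2 - (2 * a₀ + ρ / (2 * Real.pi ^ 2)) * β - β ^ 2)
    (hB : BΦ = (a₀ ^ 2 + ∑ τ ∈ T, (1 + 4 * Real.pi ^ 2 * enorm2Z d τ) * ‖aC τ‖ ^ 2) +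
      ρ ^ 2 / (16 * Real.pi ^ 4) + a₀ * ρ / (2 * Real.pi ^ 2) +
      (2 * a₀ + ρ / (2 * Real.pi ^ 2)) * β + β ^ 2) :
    0 < bΦ ∧
    ∀ z : (Fin d → ℤ) → ℂ,
      bΦ * ∑ ν ∈ Λ, ‖z ν‖ ^ 2 ≤ sqL2 d (fun x => ∑ ν ∈ Λ, z ν * Lop d a ρ (Ψ ν) x) ∧
      sqL2 d (fun x => ∑ ν ∈ Λ, z ν * Lop d a ρ (Ψ ν) x) ≤ BΦ * ∑ ν ∈ Λ, ‖z ν‖ ^ 2 := by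
  have hS : 0 ≤ ∑ τ ∈ T, (1 + 4 * Real.pi ^ 2 * enorm2Z d τ) * ‖aC τ‖ ^ 2 :=
    Finset.sum_nonneg fun τ _ => by have := enorm2Z_nonneg d τ; positivity
  have hβ0 : 0 ≤ β := by rw [hβ]; positivity
  have hw : ∑ τ ∈ T, ‖aC τ‖ * Real.sqrt (1 + 4 * Real.pi ^ 2 * enorm2Z d τ) ≤ β := by
    rw [hβ, add_sub_cancel_left, ← Real.sqrt_mul (Nat.cast_nonneg _)]
    apply Real.le_sqrt_of_sq_le
    refine sq_sum_le_card_mul_sum_sq.trans_eq ?_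
    congr 1
    refine Finset.sum_congr rfl fun τ _ => ?_
    rw [mul_pow, Real.sq_sqrt (by have := enorm2Z_nonneg d τ; positivity), mul_comm]
  set q := ρ / (2 * Real.pi ^ 2) with hq
  have hq4 : ρ / (4 * Real.pi ^ 2) = q / 2 := by rw [hq]; field_simp; norm_num
  have hq0 : 0 < q := by positivity
  rw [hq4] at hcond
  have hb0 : 0 < bΦ := by
    have h1 := lt_sub_iff_add_lt.mp hcond
    rw [Real.lt_sqrt (by positivity)] at h1
    rw [hb]
    nlinarith
  have hqβ : 0 ≤ q * β := by positivity
  have hle : β ≤ a₀ := by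
    refine abs_le_of_sq_le_sq' ?_ ha₀.le |>.2
    nlinarith [mul_nonneg ha₀.le hβ0]
  refine ⟨hb0, fun z => ?_⟩
  have hL : ∀ ν x, Lop d a ρ (Ψ ν) x = (a₀ : ℂ) * fourF d ν x +
      ∑ τ ∈ T, (aC τ * ((r ν * (4 * Real.pi ^ 2 * (dotZR d τ ν + enorm2Z d ν)) : ℝ) : ℂ)) *
        fourF d (τ + ν) x := by
    intro ν x
    rw [ha, hΨ, Lop_smul_fourF]
    congr 3
    have := enorm2Z_nonneg d ν
    have : 0 < 4 * Real.pi ^ 2 * enorm2Z d ν + ρ / a₀ := by positivity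
    have h2 : 4 * Real.pi ^ 2 * a₀ * enorm2Z d ν + ρ =
        a₀ * (4 * Real.pi ^ 2 * enorm2Z d ν + ρ / a₀) := by
      field_simp
    rw [hr, h2]
    field_simp
  have hbcf : (fun x => ∑ ν ∈ Λ, z ν * Lop d a ρ (Ψ ν) x) =
      ⇑(∑ ν ∈ Λ, z ν • ((a₀ : ℂ) • fourBCF d ν + ∑ τ ∈ T,
        (aC τ * ((r ν * (4 * Real.pi ^ 2 * (dotZR d τ ν + enorm2Z d ν)) : ℝ) : ℂ)) •
          fourBCF d (τ + ν))) := by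
    funext x
    simp only [hL, BoundedContinuousFunction.coe_sum, Finset.sum_apply,
      BoundedContinuousFunction.coe_smul, BoundedContinuousFunction.coe_add, Pi.add_apply,
      smul_eq_mul]
    rfl
  rw [hbcf, sqL2_eq_norm_toLp]
  simp only [map_sum, map_smul, map_add]
  simp only [show ∀ ν, BoundedContinuousFunction.toLp 2 (volume.restrict (Set.Icc (0 : Fin d → ℝ) 1))
    ℂ (fourBCF d ν) = fourLp d ν from fun _ => rfl]
  have hmain := abs_norm_perturbation_le (orthonormal_fourLp d) Λ T z ha₀.le aC
    (fun τ ν => r ν * (4 * Real.pi ^ 2 * (dotZR d τ ν + enorm2Z d ν)))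
    (fun τ => Real.sqrt (1 + 4 * Real.pi ^ 2 * enorm2Z d τ)) (fun τ _ => Real.sqrt_nonneg _)
    (fun τ hτ ν => by
      rw [hr]
      exact coeff_abs_le d (fun h => hT0 (h ▸ hτ)) ν (by positivity))
  set X := ‖∑ ν ∈ Λ, z ν • ((a₀ : ℂ) • fourLp d ν + ∑ τ ∈ T,
    (aC τ * ((r ν * (4 * Real.pi ^ 2 * (dotZR d τ ν + enorm2Z d ν)) : ℝ) : ℂ)) •
      fourLp d (τ + ν))‖
  have hZ : Real.sqrt (∑ ν ∈ Λ, ‖z ν‖ ^ 2) ^ 2 = ∑ ν ∈ Λ, ‖z ν‖ ^ 2 :=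
    Real.sq_sqrt (Finset.sum_nonneg fun _ _ => sq_nonneg _)
  rw [← hZ]
  set S := Real.sqrt (∑ ν ∈ Λ, ‖z ν‖ ^ 2)
  have hS0 : 0 ≤ S := Real.sqrt_nonneg _
  have hmain' := abs_le.mp (hmain.trans (mul_le_mul_of_nonneg_right hw hS0))
  constructor
  · calc bΦ * S ^ 2 ≤ (a₀ - β) ^ 2 * S ^ 2 := by
          gcongr
          nlinarith [sq_nonneg β]
      _ = ((a₀ - β) * S) ^ 2 := by ring
      _ ≤ X ^ 2 := by
          have : 0 ≤ (a₀ - β) * S := mul_nonneg (by linarith) hS0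
          gcongr
          linarith [hmain'.1]
  · calc X ^ 2 ≤ ((a₀ + β) * S) ^ 2 := by
          have : 0 ≤ X := norm_nonneg _
          gcongr
          linarith [hmain'.2]
      _ = (a₀ + β) ^ 2 * S ^ 2 := by ring
      _ ≤ BΦ * S ^ 2 := by
          gcongr
          have : 0 ≤ ρ ^ 2 / (16 * Real.pi ^ 4) := by positivity
          have : 0 ≤ a₀ * ρ / (2 * Real.pi ^ 2) := by positivity
          rw [hB]
          nlinarith
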